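/- Let A > 0, C > 0 and 0 < θ < 1/(2A), and assume the local Bernstein condition at radius √C: every f ∈ F with ‖f−f*‖²_{L₂} = C satisfies ‖f−f*‖²_{L₂} ≤ A · P𝓛_f. On the event Ω_K (defined in the context), one has sup_{f ∈ F : ‖f−f*‖²_{L₂} > C} MOM_K(ℓ_{f*} − ℓ_f) < −θC and sup_{f ∈ F : ‖f−f*‖²_{L₂} ≤ C} MOM_K(ℓ_{f*} − ℓ_f) ≤ θC. -/

import Mathlib

open MeasureTheory ProbabilityTheory Real

lemma med_inter_aux {K : ℕ} (p q : Fin K → Prop) [DecidablePred p] [DecidablePred q]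
    (h1 : K ≤ 2 * (Finset.univ.filter p).card)
    (h2 : K < 2 * (Finset.univ.filter q).card) : ∃ k, p k ∧ q k := by
  by_contra! hcon
  have hd : Disjoint (Finset.univ.filter p) (Finset.univ.filter q) := by
    rw [Finset.disjoint_filter]
    exact fun k _ hp => hcon k hp
  have h3 := Finset.card_union_of_disjoint hd
  have h4 := Finset.card_le_univ (Finset.univ.filter p ∪ Finset.univ.filter q)
  rw [Fintype.card_fin] at h4
  omega

/-- on the event Ω_K (more than K/2 blocks with deviations at
most θC for every f in the localized ball), under the local Bernstein
condition, the MOM criterion separates the exterior of the ball from the ball. -/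
theorem mom_separation_on_event
    {𝒳 : Type*} [MeasurableSpace 𝒳]
    (P : Measure (𝒳 × ℝ)) [IsProbabilityMeasure P]
    -- the convex class F
    (F : Set (𝒳 → ℝ))
    (hFconv : ∀ f ∈ F, ∀ g ∈ F, ∀ t : ℝ, 0 ≤ t → t ≤ 1 →
      (fun x => t * f x + (1 - t) * g x) ∈ F)
    -- the loss, convex and L-Lipschitz in its first argument
    (L : ℝ) (hL : 0 < L) (ℓ : ℝ → ℝ → ℝ)
    (hconv : ∀ y : ℝ, ConvexOn ℝ Set.univ fun u => ℓ u y)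
    (hlip : ∀ y : ℝ, LipschitzWith (Real.toNNReal L) fun u => ℓ u y)
    -- the oracle: unique risk minimizer over F
    (fstar : 𝒳 → ℝ) (hfstarF : fstar ∈ F)
    (hfstarMin : ∀ f ∈ F, (∫ z, ℓ (fstar z.1) z.2 ∂P) ≤ ∫ z, ℓ (f z.1) z.2 ∂P)
    (hfstarUnique : ∀ f ∈ F,
      (∫ z, ℓ (f z.1) z.2 ∂P) = (∫ z, ℓ (fstar z.1) z.2 ∂P) → f = fstar)
    -- excess risk P𝓛_f and L₂(μ) norm, μ being the first marginal of P
    (PL : (𝒳 → ℝ) → ℝ)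
    (hPL : ∀ f, PL f = ∫ z, (ℓ (f z.1) z.2 - ℓ (fstar z.1) z.2) ∂P)
    (norm2 : (𝒳 → ℝ) → ℝ)
    (hnorm2 : ∀ g : 𝒳 → ℝ, norm2 g = Real.sqrt (∫ x, g x ^ 2 ∂(P.map Prod.fst)))
    -- data points (a realization in the event Ω_K), blocks of equal size N/K
    (N K : ℕ) (hN : 0 < N) (hK : 0 < K) (hKdvd : K ∣ N)
    (data : Fin N → 𝒳 × ℝ)
    (Bl : Fin K → Finset (Fin N))
    (hBlDisj : Set.PairwiseDisjoint Set.univ Bl)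
    (hBlUnion : ∀ i : Fin N, ∃ k, i ∈ Bl k)
    (hBlCard : ∀ k, (Bl k).card = N / K)
    -- a median operator
    (med : ∀ m : ℕ, (Fin m → ℝ) → ℝ)
    (hmed : ∀ (m : ℕ) (v : Fin m → ℝ),
      m ≤ 2 * (Finset.univ.filter fun k => v k ≤ med m v).card ∧
      m ≤ 2 * (Finset.univ.filter fun k => med m v ≤ v k).card)
    -- constants, local Bernstein condition at radius √C
    (A C θ : ℝ) (hA : 0 < A) (hC : 0 < C) (hθ : 0 < θ) (hθA : θ < 1 / (2 * A))
    (hBern : ∀ f ∈ F, (norm2 fun x => f x - fstar x) ^ 2 = C →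
      (norm2 fun x => f x - fstar x) ^ 2 ≤ A * PL f)
    -- we are on the event Ω_K
    (hΩ : ∀ f ∈ F, (norm2 fun x => f x - fstar x) ^ 2 ≤ C →
      K < 2 * (Finset.univ.filter fun k : Fin K =>
        |(K / N : ℝ) * (∑ i ∈ Bl k,
            (ℓ (f (data i).1) (data i).2 - ℓ (fstar (data i).1) (data i).2)) - PL f|
          ≤ θ * C).card) :
    (∀ f ∈ F, C < (norm2 fun x => f x - fstar x) ^ 2 →
      med K (fun k => (K / N : ℝ) * ∑ i ∈ Bl k,
          (ℓ (fstar (data i).1) (data i).2 - ℓ (f (data i).1) (data i).2))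
        < -(θ * C)) ∧
    ((⨆ f : {f : 𝒳 → ℝ // f ∈ F ∧ (norm2 fun x => f x - fstar x) ^ 2 ≤ C},
        med K (fun k => (K / N : ℝ) * ∑ i ∈ Bl k,
          (ℓ (fstar (data i).1) (data i).2 - ℓ ((f : 𝒳 → ℝ) (data i).1) (data i).2)))
      ≤ θ * C) := by
  have hneg : ∀ (f : 𝒳 → ℝ) (k : Fin K), (K / N : ℝ) * ∑ i ∈ Bl k,
      (ℓ (fstar (data i).1) (data i).2 - ℓ (f (data i).1) (data i).2)
      = -((K / N : ℝ) * ∑ i ∈ Bl k,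
      (ℓ (f (data i).1) (data i).2 - ℓ (fstar (data i).1) (data i).2)) := by
    intro f k
    rw [← mul_neg, ← Finset.sum_neg_distrib]
    simp only [neg_sub]
  have hKN : (0 : ℝ) ≤ K / N := by positivity
  constructor
  · intro f hf hfC
    set n2 := (norm2 fun x => f x - fstar x) ^ 2 with hn2
    have hn2pos : 0 < n2 := hC.trans hfC
    set a := Real.sqrt (C / n2) with ha
    have ha2 : a ^ 2 = C / n2 := Real.sq_sqrt (by positivity)
    have ha0 : 0 < a := Real.sqrt_pos.mpr (by positivity)
    have ha1 : a ≤ 1 := by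
      rw [ha, Real.sqrt_le_iff, one_pow, div_le_one hn2pos]
      exact ⟨zero_le_one, hfC.le⟩
    have hsq : ∀ g : 𝒳 → ℝ, norm2 g ^ 2 = ∫ x, g x ^ 2 ∂(P.map Prod.fst) := by
      intro g
      rw [hnorm2, Real.sq_sqrt (integral_nonneg fun x => sq_nonneg _)]
    set f0 : 𝒳 → ℝ := fun x => a * f x + (1 - a) * fstar x with hf0
    have hf0F : f0 ∈ F := hFconv f hf fstar hfstarF a ha0.le ha1
    have hf0C : (norm2 fun x => f0 x - fstar x) ^ 2 = C := by
      rw [hsq]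
      have : (fun x => (f0 x - fstar x) ^ 2) = fun x => a ^ 2 * (f x - fstar x) ^ 2 := by
        funext x
        simp only [hf0]
        ring
      rw [this, integral_const_mul, ← hsq (fun x => f x - fstar x), ← hn2, ha2]
      field_simp
    have hB := hBern f0 hf0F hf0C
    rw [hf0C] at hB
    have hPL0 : 2 * (θ * C) < PL f0 := by
      rw [lt_div_iff₀ (by positivity)] at hθA
      have h1 : θ * (2 * A) * C < 1 * C := mul_lt_mul_of_pos_right hθA hC
      have h2 : A * (2 * (θ * C)) < A * PL f0 := by nlinarith
      exact lt_of_mul_lt_mul_left h2 hA.le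
    obtain ⟨k, hk1, hk2⟩ := med_inter_aux _ _ (hmed K (fun k => (K / N : ℝ) * ∑ i ∈ Bl k,
          (ℓ (fstar (data i).1) (data i).2 - ℓ (f (data i).1) (data i).2))).2
          (hΩ f0 hf0F hf0C.le)
    refine lt_of_le_of_lt hk1 ?_
    rw [hneg]
    apply neg_lt_neg
    have h3 := (abs_le.mp hk2).1
    have hcv : (K / N : ℝ) * ∑ i ∈ Bl k,
        (ℓ (f0 (data i).1) (data i).2 - ℓ (fstar (data i).1) (data i).2)
        ≤ a * ((K / N : ℝ) * ∑ i ∈ Bl k,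
        (ℓ (f (data i).1) (data i).2 - ℓ (fstar (data i).1) (data i).2)) := by
      rw [mul_left_comm]
      apply mul_le_mul_of_nonneg_left _ hKN
      rw [Finset.mul_sum]
      apply Finset.sum_le_sum
      intro i _
      have := (hconv (data i).2).2 (Set.mem_univ (f (data i).1))
        (Set.mem_univ (fstar (data i).1)) ha0.le (sub_nonneg.mpr ha1) (by ring)
      simp only [smul_eq_mul] at this
      simp only [hf0]
      linarith
    have hpos : 0 < θ * C := by positivity
    set S := (K / N : ℝ) * ∑ i ∈ Bl k,
        (ℓ (f (data i).1) (data i).2 - ℓ (fstar (data i).1) (data i).2)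
    have h4 : θ * C < a * S := by linarith
    have hS : 0 < S := pos_of_mul_pos_right (hpos.trans h4) ha0.le
    nlinarith
  · apply Real.iSup_le _ (by positivity)
    rintro ⟨f, hf, hfC⟩
    have hPLn : 0 ≤ PL f := by
      rw [hPL]
      by_cases hd : Integrable (fun z : 𝒳 × ℝ => ℓ (f z.1) z.2 - ℓ (fstar z.1) z.2) P
      · by_cases hs : Integrable (fun z : 𝒳 × ℝ => ℓ (fstar z.1) z.2) P
        · have hfi : Integrable (fun z : 𝒳 × ℝ => ℓ (f z.1) z.2) P := by
            refine (hd.add hs).congr (Filter.Eventually.of_forall fun z => ?_)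
            simp
          rw [integral_sub hfi hs]
          linarith [hfstarMin f hf]
        · have hfi : ¬ Integrable (fun z : 𝒳 × ℝ => ℓ (f z.1) z.2) P := by
            intro hfi
            apply hs
            refine (hfi.sub hd).congr (Filter.Eventually.of_forall fun z => ?_)
            simp
          have := hfstarUnique f hf (by rw [integral_undef hs, integral_undef hfi])
          subst this
          simp
      · rw [integral_undef hd]
    obtain ⟨k, hk1, hk2⟩ := med_inter_aux _ _ (hmed K (fun k => (K / N : ℝ) * ∑ i ∈ Bl k,
          (ℓ (fstar (data i).1) (data i).2 - ℓ (f (data i).1) (data i).2))).2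
          (hΩ f hf hfC)
    refine le_trans hk1 ?_
    rw [hneg]
    have h3 := (abs_le.mp hk2).1
    linarith
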